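/- arXiv:1303.2103 — 2 statements merged into one kernel-verified Lean document; each statement's English description precedes it below -/
import Mathlib

section
/- Let Δ : ℕ^(2) ↠ [k] be a surjective colouring and suppose n ≥ 1 is a natural number such that k ≥ n(n-1)/2 + 1. Then there exists an n-tuple (X₁,...,Xₙ) of nonempty subsets of ℕ that is n-homogeneous with respect to Δ. -/
/-- The colour of the unordered edge `{x, y}` (only values on distinct pairs matter). -/
def edgeCol (Δ : ℕ → ℕ → ℕ) (x y : ℕ) : ℕ := Δ (min x y) (max x y)

/-- `colourSet Δ X` is the set of colours attained by `Δ` on edges with both endpoints in `X`. -/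
def colourSet (Δ : ℕ → ℕ → ℕ) (X : Set ℕ) : Set ℕ :=
  {c | ∃ x ∈ X, ∃ y ∈ X, x ≠ y ∧ edgeCol Δ x y = c}

/-- `Δ` is a surjective colouring `ℕ^(2) ↠ [k]` of the edges of the complete
graph on `ℕ` with colour set `[k] = {1, …, k}`. -/
def IsColouring (Δ : ℕ → ℕ → ℕ) (k : ℕ) : Prop :=
  (∀ x y : ℕ, x ≠ y → edgeCol Δ x y ∈ Finset.Icc 1 k) ∧
  (∀ c ∈ Finset.Icc 1 k, ∃ x y : ℕ, x ≠ y ∧ edgeCol Δ x y = c)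

/-- `F_Δ`: the set of `m ∈ [k]` for which some infinite `X ⊆ ℕ` is exactly `m`-coloured. -/
def FSet (Δ : ℕ → ℕ → ℕ) (k : ℕ) : Set ℕ :=
  {m | m ∈ Finset.Icc 1 k ∧ ∃ X : Set ℕ, X.Infinite ∧ (colourSet Δ X).ncard = m}

/-- `N_Δ(v, X)`: the set of new colours from `v` into `X`, i.e. colours appearing on some
edge from `v` to `X` but on no edge inside `X`. -/
def newCols (Δ : ℕ → ℕ → ℕ) (v : ℕ) (X : Set ℕ) : Set ℕ :=
  {c | (∃ x ∈ X, x ≠ v ∧ edgeCol Δ v x = c) ∧ c ∉ colourSet Δ X}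

/-- `X̄ᵢ = X₀ ∪ X₁ ∪ ⋯ ∪ Xᵢ` (0-indexed). -/
def barU (X : ℕ → Set ℕ) (i : ℕ) : Set ℕ := ⋃ j ≤ i, X j

/-- The tuple `(X 0, …, X (n-1))` is `n`-homogeneous with respect to `Δ` (0-indexed):
the sets are nonempty and pairwise disjoint; `X 0` is infinite and exactly 1-coloured;
the colour sets of the partial unions form a strictly increasing chain; every vertex of
`X (i+1)` sees exactly the colours of `Δ(X̄ᵢ₊₁^(2)) \ Δ(X̄ᵢ^(2))` as new colours into `X̄ᵢ`;
and the full union spans at most `n(n-1)/2 + 1` colours. -/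
def Homog (Δ : ℕ → ℕ → ℕ) (n : ℕ) (X : ℕ → Set ℕ) : Prop :=
  (∀ i < n, (X i).Nonempty) ∧
  (∀ i < n, ∀ j < n, i ≠ j → Disjoint (X i) (X j)) ∧
  ((X 0).Infinite ∧ (colourSet Δ (X 0)).ncard = 1) ∧
  (∀ i, i + 1 < n → colourSet Δ (barU X i) ⊂ colourSet Δ (barU X (i + 1))) ∧
  (∀ i, i + 1 < n → ∀ v ∈ X (i + 1),
      newCols Δ v (barU X i) = colourSet Δ (barU X (i + 1)) \ colourSet Δ (barU X i)) ∧
  ((colourSet Δ (barU X (n - 1))).Finite ∧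
    (colourSet Δ (barU X (n - 1))).ncard ≤ n * (n - 1) / 2 + 1)

theorem edgeCol_comm (Δ : ℕ → ℕ → ℕ) (x y : ℕ) : edgeCol Δ x y = edgeCol Δ y x := by
  simp only [edgeCol, min_comm, max_comm]

theorem colourSet_mono (Δ : ℕ → ℕ → ℕ) {A B : Set ℕ} (h : A ⊆ B) :
    colourSet Δ A ⊆ colourSet Δ B := by
  rintro c ⟨x, hx, y, hy, hxy, rfl⟩
  exact ⟨x, h hx, y, h hy, hxy, rfl⟩

theorem colourSet_insert (Δ : ℕ → ℕ → ℕ) {B : Set ℕ} {u : ℕ} (hu : u ∉ B) :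
    colourSet Δ (insert u B) = colourSet Δ B ∪ newCols Δ u B := by
  ext c
  constructor
  · rintro ⟨x, hx, y, hy, hxy, rfl⟩
    by_cases hc : edgeCol Δ x y ∈ colourSet Δ B
    · exact Or.inl hc
    · right
      rcases hx with rfl | hx
      · rcases hy with rfl | hy
        · exact absurd rfl hxy
        · exact ⟨⟨y, hy, hxy.symm, rfl⟩, hc⟩
      · rcases hy with rfl | hy
        · exact ⟨⟨x, hx, hxy, edgeCol_comm Δ y x⟩, hc⟩
        · exact absurd ⟨x, hx, y, hy, hxy, rfl⟩ hc
  · rintro (hc | ⟨⟨x, hx, hxu, rfl⟩, -⟩)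
    · exact colourSet_mono Δ (Set.subset_insert u B) hc
    · exact ⟨u, Set.mem_insert _ _, x, Set.mem_insert_of_mem _ hx, hxu.symm, rfl⟩

theorem colourSet_finite {Δ : ℕ → ℕ → ℕ} {k : ℕ} (hΔ : IsColouring Δ k) (B : Set ℕ) :
    (colourSet Δ B).Finite := by
  refine (Finset.Icc 1 k).finite_toSet.subset ?_
  rintro c ⟨x, -, y, -, hxy, rfl⟩
  exact hΔ.1 x y hxy

theorem colourSet_univ {Δ : ℕ → ℕ → ℕ} {k : ℕ} (hΔ : IsColouring Δ k) :
    colourSet Δ Set.univ = Finset.Icc 1 k := by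
  ext c
  constructor
  · rintro ⟨x, -, y, -, hxy, rfl⟩
    exact hΔ.1 x y hxy
  · intro hc
    obtain ⟨x, y, hxy, h⟩ := hΔ.2 c hc
    exact ⟨x, trivial, y, trivial, hxy, h⟩

theorem colourSet_nonempty (Δ : ℕ → ℕ → ℕ) {A : Set ℕ} (hA : A.Infinite) :
    (colourSet Δ A).Nonempty := by
  obtain ⟨x, hx, y, hy, hxy⟩ := hA.nontrivial
  exact ⟨_, x, hx, y, hy, hxy, rfl⟩

/-- Infinite Ramsey theorem for pairs: a finite colouring has an infinite monochromatic set. -/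
theorem exists_infinite_colourSet_eq_singleton {Δ : ℕ → ℕ → ℕ} {k : ℕ} (hΔ : IsColouring Δ k) :
    ∃ (A : Set ℕ) (c : ℕ), A.Infinite ∧ colourSet Δ A = {c} := by
  let U : Ultrafilter ℕ := Filter.hyperfilter ℕ
  have hU : ∀ x : ℕ, ∀ᶠ y in (U : Filter ℕ), x < y := fun x => by
    have h : ∀ᶠ y in Filter.cofinite, x < y := by
      rw [Nat.cofinite_eq_atTop]
      exact Filter.eventually_gt_atTop x
    exact Filter.hyperfilter_le_cofinite h
  have pigeon : ∀ f : ℕ → ℕ, (∀ᶠ y in (U : Filter ℕ), f y ∈ Finset.Icc 1 k) →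
      ∃ c, ∀ᶠ y in (U : Filter ℕ), f y = c := by
    intro f hf
    have h : (⋃ c ∈ (Finset.Icc 1 k : Set ℕ), {y | f y = c}) ∈ U := by
      filter_upwards [hf] with y hy
      simpa using hy
    obtain ⟨c, -, hc⟩ := (Ultrafilter.finite_biUnion_mem_iff (Finset.finite_toSet _)).1 h
    exact ⟨c, hc⟩
  have h1 : ∀ x, ∃ c, ∀ᶠ y in (U : Filter ℕ), edgeCol Δ x y = c := fun x =>
    pigeon _ ((hU x).mono fun y hy => hΔ.1 x y hy.ne)
  choose g hg using h1
  obtain ⟨c, hc⟩ := pigeon g (Filter.Eventually.of_forall fun x => by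
    obtain ⟨y, hy, hxy⟩ := ((hg x).and (hU x)).exists
    exact hy ▸ hΔ.1 x y hxy.ne)
  obtain ⟨f, -, hf⟩ := exists_seq_of_forall_finset_exists (fun x => g x = c)
    (fun x y => x < y ∧ edgeCol Δ x y = c) (fun s hs => by
      have h : ∀ᶠ y in (U : Filter ℕ), ∀ x ∈ s, x < y ∧ edgeCol Δ x y = c := by
        rw [Filter.eventually_all_finset]
        intro x hx
        have := hg x
        rw [hs x hx] at this
        exact (hU x).and this
      exact (hc.and h).exists)
  have hmono : StrictMono f := fun m n h => (hf m n h).1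
  have hinf := Set.infinite_range_of_injective hmono.injective
  refine ⟨Set.range f, c, hinf, ?_⟩
  refine (colourSet_nonempty Δ hinf).subset_singleton_iff.1 ?_
  rintro d ⟨_, ⟨m, rfl⟩, _, ⟨n, rfl⟩, hne, rfl⟩
  rcases lt_trichotomy m n with h | rfl | h
  · exact (hf m n h).2
  · exact absurd rfl hne
  · rw [edgeCol_comm]
    exact (hf n m h).2

/-- `Layered Δ n B` says that `B` is the union of an `n`-tuple satisfying every condition of
`n`-homogeneity except the bound on the total number of colours. -/
inductive Layered (Δ : ℕ → ℕ → ℕ) : ℕ → Set ℕ → Prop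
  | base (A : Set ℕ) (c : ℕ) (hA : A.Infinite) (hc : colourSet Δ A = {c}) : Layered Δ 1 A
  | snoc (n : ℕ) (B Y E : Set ℕ) (hB : Layered Δ n B) (hY : Y.Nonempty) (hYB : Disjoint B Y)
      (hE : E.Nonempty) (hN : ∀ v ∈ Y, newCols Δ v B = E)
      (hC : colourSet Δ (B ∪ Y) = colourSet Δ B ∪ E) : Layered Δ (n + 1) (B ∪ Y)

namespace Layered

variable {Δ : ℕ → ℕ → ℕ} {n : ℕ} {B : Set ℕ}

theorem insert_of_newCols (h : Layered Δ n B) {u : ℕ} (hu : u ∉ B)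
    (hN : (newCols Δ u B).Nonempty) : Layered Δ (n + 1) (insert u B) := by
  rw [Set.insert_eq, Set.union_comm]
  refine snoc n B {u} _ h (Set.singleton_nonempty u) (by simpa) hN (by simp) ?_
  rw [Set.union_comm, ← Set.insert_eq, colourSet_insert Δ hu]

/-- A vertex sending no new colour can be absorbed into some layer, or else forms a layer of
its own. -/
theorem insert_of_newCols_eq_empty (h : Layered Δ n B) {u : ℕ} (hu : u ∉ B)
    (hN : newCols Δ u B = ∅) : Layered Δ n (insert u B) ∨ Layered Δ (n + 1) (insert u B) := by
  induction h with
  | base A c hA hc =>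
    left
    refine base _ c (hA.mono (Set.subset_insert u A)) ?_
    rw [colourSet_insert Δ hu, hN, Set.union_empty, hc]
  | snoc n B Y E hB hY hYB hE hNE hC ih =>
    have huB : u ∉ B := fun h => hu (Or.inl h)
    have huY : u ∉ Y := fun h => hu (Or.inr h)
    have hC' : colourSet Δ (insert u (B ∪ Y)) = colourSet Δ B ∪ E := by
      rw [colourSet_insert Δ hu, hN, Set.union_empty, hC]
    have hdisj : Disjoint (insert u B) Y := Set.disjoint_insert_left.2 ⟨huY, hYB⟩
    have hEB : ∀ c ∈ E, c ∉ colourSet Δ B := by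
      obtain ⟨y, hy⟩ := hY
      intro c hc
      rw [← hNE y hy] at hc
      exact hc.2
    have hDE : newCols Δ u B ⊆ E := by
      intro c hc
      have hcol : c ∈ colourSet Δ (insert u (B ∪ Y)) :=
        colourSet_mono Δ (Set.insert_subset_insert Set.subset_union_left)
          (by rw [colourSet_insert Δ huB]; exact Or.inr hc)
      rw [hC'] at hcol
      exact hcol.resolve_left hc.2
    have hNY : ∀ v ∈ Y, newCols Δ v (insert u B) = E \ newCols Δ u B := by
      intro v hv
      have hvu : u ≠ v := fun h => huY (h ▸ hv)
      ext c
      simp only [newCols, colourSet_insert Δ huB, Set.mem_sdiff]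
      constructor
      · rintro ⟨⟨x, hx, hxv, rfl⟩, hc⟩
        have hcol : edgeCol Δ v x ∈ colourSet Δ (insert u (B ∪ Y)) := by
          refine ⟨v, Or.inr (Or.inr hv), x, ?_, hxv.symm, rfl⟩
          exact Set.insert_subset_insert Set.subset_union_left hx
        rw [hC'] at hcol
        exact ⟨hcol.resolve_left fun h => hc (Or.inl h), fun h => hc (Or.inr h)⟩
      · rintro ⟨hc, hcu⟩
        have hcB := hEB c hc
        rw [← hNE v hv] at hc
        obtain ⟨⟨x, hx, hxv, rfl⟩, -⟩ := hc
        exact ⟨⟨x, Or.inr hx, hxv, rfl⟩, fun h => h.elim hcB hcu⟩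
    by_cases hD : newCols Δ u B = ∅
    · have key : ∀ m, Layered Δ m (insert u B) → Layered Δ (m + 1) (insert u (B ∪ Y)) := by
        intro m hm
        rw [← Set.insert_union]
        refine snoc m _ Y E hm hY hdisj hE (fun v hv => ?_) ?_
        · rw [hNY v hv, hD, Set.sdiff_empty]
        · rw [Set.insert_union, hC', colourSet_insert Δ huB, hD, Set.union_empty]
      exact (ih huB hD).imp (key _) (key _)
    · by_cases hDE' : newCols Δ u B = E
      · left
        rw [← Set.union_insert]
        refine snoc n B _ E hB (Set.insert_nonempty _ _)
          (Set.disjoint_insert_right.2 ⟨huB, hYB⟩) hE ?_ (by rw [Set.union_insert, hC'])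
        rintro v (rfl | hv)
        exacts [hDE', hNE v hv]
      · right
        rw [← Set.insert_union]
        refine snoc (n + 1) _ Y (E \ newCols Δ u B)
          (hB.insert_of_newCols huB (Set.nonempty_iff_ne_empty.2 hD)) hY hdisj
          (Set.sdiff_nonempty.2 fun h => hDE' (hDE.antisymm h)) hNY ?_
        rw [Set.insert_union, hC', colourSet_insert Δ huB, Set.union_assoc,
          Set.union_sdiff_cancel hDE]

/-- A layered set can be extended by one layer inside any larger set that has more colours,
either gaining at most one colour or gaining just the new colours of a single vertex. -/
theorem exists_extension (h : Layered Δ n B) {W : Set ℕ} (hBW : B ⊆ W)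
    (hW : ¬ colourSet Δ W ⊆ colourSet Δ B) :
    ∃ B', Layered Δ (n + 1) B' ∧ B ⊆ B' ∧ B' ⊆ W ∧
      ((∃ d, colourSet Δ B' ⊆ insert d (colourSet Δ B)) ∨
        ∃ x ∈ W, x ∉ B ∧ (newCols Δ x B).Nonempty ∧ B' = insert x B) := by
  by_cases hx : ∃ x ∈ W, x ∉ B ∧ (newCols Δ x B).Nonempty
  · obtain ⟨x, hxW, hxB, hN⟩ := hx
    exact ⟨insert x B, h.insert_of_newCols hxB hN, Set.subset_insert _ _,
      Set.insert_subset hxW hBW, Or.inr ⟨x, hxW, hxB, hN, rfl⟩⟩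
  · have hfree : ∀ x ∈ W, x ∉ B → newCols Δ x B = ∅ := fun x hxW hxB =>
      Set.not_nonempty_iff_eq_empty.1 fun hN => hx ⟨x, hxW, hxB, hN⟩
    obtain ⟨d, ⟨u, hu, y, hy, huy, hd⟩, hdB⟩ := Set.not_subset.1 hW
    have huB : u ∉ B := fun huB => by
      have hyB : y ∉ B := fun hyB => hdB ⟨u, huB, y, hyB, huy, hd⟩
      have : d ∈ newCols Δ y B := ⟨⟨u, huB, huy, by rw [edgeCol_comm, hd]⟩, hdB⟩
      simp [hfree y hy hyB] at this
    have hyB : y ∉ B := fun hyB => by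
      have : d ∈ newCols Δ u B := ⟨⟨y, hyB, huy.symm, hd⟩, hdB⟩
      simp [hfree u hu huB] at this
    have hCu : colourSet Δ (insert u B) = colourSet Δ B := by
      rw [colourSet_insert Δ huB, hfree u hu huB, Set.union_empty]
    have hyu : y ∉ insert u B := by
      rintro (rfl | h)
      exacts [huy rfl, hyB h]
    have hNy : newCols Δ y (insert u B) ⊆ {d} := by
      rintro c ⟨⟨x, rfl | hxB, hxy, rfl⟩, hc⟩
      · rw [edgeCol_comm, hd]
        rfl
      · rw [hCu] at hc
        have : edgeCol Δ y x ∈ newCols Δ y B := ⟨⟨x, hxB, hxy, rfl⟩, hc⟩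
        simp [hfree y hy hyB] at this
    rcases h.insert_of_newCols_eq_empty huB (hfree u hu huB) with h' | h'
    · refine ⟨_, h'.insert_of_newCols hyu
        ⟨d, ⟨u, Set.mem_insert _ _, huy, by rw [edgeCol_comm, hd]⟩, by rwa [hCu]⟩,
        (Set.subset_insert _ _).trans (Set.subset_insert _ _),
        Set.insert_subset hy (Set.insert_subset hu hBW), Or.inl ⟨d, ?_⟩⟩
      rw [colourSet_insert Δ hyu, hCu, Set.insert_eq, Set.union_comm]
      exact Set.union_subset_union_left _ hNy
    · refine ⟨_, h', Set.subset_insert _ _, Set.insert_subset hu hBW, Or.inl ⟨d, ?_⟩⟩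
      rw [hCu]
      exact Set.subset_insert _ _

theorem exists_infinite_subset (h : Layered Δ n B) :
    ∃ A ⊆ B, ∃ c, A.Infinite ∧ colourSet Δ A = {c} := by
  induction h with
  | base A c hA hc => exact ⟨A, subset_rfl, c, hA, hc⟩
  | snoc n B Y E _ _ _ _ _ _ ih =>
    obtain ⟨A, hA, h⟩ := ih
    exact ⟨A, hA.trans Set.subset_union_left, h⟩

/-- A vertex sending many new colours into a layered set yields layered sets, of every length up
to that number, each layer of which costs at most one additional colour. -/
theorem exists_of_le_ncard_newCols {k : ℕ} (hΔ : IsColouring Δ k) (h : Layered Δ n B) {v : ℕ}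
    (hv : v ∉ B) {m : ℕ} (hm : 1 ≤ m) (hmD : m ≤ (newCols Δ v B).ncard) :
    ∃ (T : Set ℕ) (S : Finset ℕ), Layered Δ (m + 1) T ∧ v ∈ T ∧ T ⊆ insert v B ∧
      S.card ≤ m ∧ colourSet Δ T ⊆ colourSet Δ B ∪ S := by
  have step : ∀ (L : ℕ) (T : Set ℕ) (S : Finset ℕ), L + 1 ≤ (newCols Δ v B).ncard →
      Layered Δ (L + 1) T → v ∈ T → T ⊆ insert v B → S.card ≤ L →
      colourSet Δ T ⊆ colourSet Δ B ∪ S →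
      ∃ (T : Set ℕ) (S : Finset ℕ), Layered Δ (L + 1 + 1) T ∧ v ∈ T ∧ T ⊆ insert v B ∧
        S.card ≤ L + 1 ∧ colourSet Δ T ⊆ colourSet Δ B ∪ S := by
    intro L T S hL hT hvT hTB hS hTS
    have hW : ¬ colourSet Δ (insert v B) ⊆ colourSet Δ T := by
      intro hsub
      have hDS : newCols Δ v B ⊆ S := by
        intro c hc
        refine (hTS (hsub ?_)).resolve_left hc.2
        rw [colourSet_insert Δ hv]
        exact Or.inr hc
      have := Set.ncard_le_ncard hDS S.finite_toSet
      rw [Set.ncard_coe_finset] at this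
      omega
    obtain ⟨T', hT', hTT', hT'W, hcol⟩ := hT.exists_extension hTB hW
    have hd : ∃ d, colourSet Δ T' ⊆ insert d (colourSet Δ B ∪ S) := by
      rcases hcol with ⟨d, hd⟩ | ⟨x, hxW, hxT, -, rfl⟩
      · exact ⟨d, hd.trans (Set.insert_subset_insert hTS)⟩
      · refine ⟨edgeCol Δ x v, ?_⟩
        rw [colourSet_insert Δ hxT]
        refine Set.union_subset (hTS.trans (Set.subset_insert _ _)) ?_
        rintro c ⟨⟨y, hy, hyx, rfl⟩, -⟩
        have hxB : x ∈ B := hxW.resolve_left fun h => hxT (h ▸ hvT)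
        rcases hTB hy with rfl | hyB
        · exact Set.mem_insert _ _
        · exact Or.inr (Or.inl ⟨x, hxB, y, hyB, hyx.symm, rfl⟩)
    obtain ⟨d, hd⟩ := hd
    refine ⟨T', insert d S, hT', hTT' hvT, hT'W, (Finset.card_insert_le d S).trans (by omega), ?_⟩
    rwa [Finset.coe_insert, Set.union_insert]
  have start : ∃ (T : Set ℕ) (S : Finset ℕ), v ∈ T ∧ T ⊆ insert v B ∧
      colourSet Δ T ⊆ colourSet Δ B ∪ S ∧
      ((Layered Δ (0 + 1) T ∧ S.card ≤ 0) ∨ (Layered Δ (1 + 1) T ∧ S.card ≤ 1)) := by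
    obtain ⟨A, hAB, c, hA, hc⟩ := h.exists_infinite_subset
    obtain ⟨e, he⟩ : ∃ e, {x ∈ A | edgeCol Δ v x = e}.Infinite := by
      by_contra! hcon
      refine hA (((Finset.Icc 1 k).finite_toSet.biUnion fun e _ => hcon e).subset ?_)
      intro x hx
      simp only [Set.mem_iUnion]
      exact ⟨_, hΔ.1 v x (fun h => hv (h ▸ hAB hx)), hx, rfl⟩
    set A' := {x ∈ A | edgeCol Δ v x = e} with hA'
    have hA'A : A' ⊆ A := Set.sep_subset _ _
    have hvA' : v ∉ A' := fun h => hv (hAB (hA'A h))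
    have hcA' : colourSet Δ A' = {c} :=
      (colourSet_nonempty Δ he).subset_singleton_iff.1 (hc ▸ colourSet_mono Δ hA'A)
    have hcB : c ∈ colourSet Δ B := colourSet_mono Δ hAB (hc ▸ Set.mem_singleton c)
    have hN : newCols Δ v A' ⊆ {e} := by
      rintro _ ⟨⟨x, hx, -, rfl⟩, -⟩
      exact hx.2
    refine ⟨insert v A', if e = c then ∅ else {e}, Set.mem_insert _ _,
      Set.insert_subset_insert (hA'A.trans hAB), ?_, ?_⟩
    · rw [colourSet_insert Δ hvA', hcA']
      rintro d (rfl | hd)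
      · exact Or.inl hcB
      · obtain rfl := hN hd
        split_ifs with hec
        · exact Or.inl (hec ▸ hcB)
        · exact Or.inr (by simp)
    · have hbase : Layered Δ 1 A' := base A' c he hcA'
      split_ifs with hec
      · refine Or.inl ⟨base _ c (he.mono (Set.subset_insert _ _)) ?_, by simp⟩
        rw [colourSet_insert Δ hvA', hcA', Set.union_eq_left]
        exact hec ▸ hN
      · obtain ⟨x, hx⟩ := he.nonempty
        refine Or.inr ⟨hbase.insert_of_newCols hvA' ⟨e, ⟨x, hx, ?_, hx.2⟩, ?_⟩, by simp⟩
        · exact fun h => hvA' (h ▸ hx)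
        · simpa [hcA'] using hec
  induction m, hm using Nat.le_induction with
  | base =>
    obtain ⟨T, S, hvT, hTB, hTS, ⟨hT, hS⟩ | ⟨hT, hS⟩⟩ := start
    · exact step 0 T S hmD hT hvT hTB hS hTS
    · exact ⟨T, S, hT, hvT, hTB, hS, hTS⟩
  | succ m hm ih =>
    obtain ⟨T, S, hT, hvT, hTB, hS, hTS⟩ := ih (by omega)
    exact step m T S hmD hT hvT hTB hS hTS

theorem exists_ncard_le {k : ℕ} (hΔ : IsColouring Δ k) (hn : 1 ≤ n)
    (hk : n * (n - 1) / 2 + 1 ≤ k) :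
    ∃ B, Layered Δ n B ∧ (colourSet Δ B).ncard ≤ n * (n - 1) / 2 + 1 := by
  induction n, hn using Nat.le_induction with
  | base =>
    obtain ⟨A, c, hA, hc⟩ := exists_infinite_colourSet_eq_singleton hΔ
    exact ⟨A, base A c hA hc, by simp [hc]⟩
  | succ n hn ih =>
    have htri := Nat.triangle_succ n
    obtain ⟨B, hB, hBc⟩ := ih (by omega)
    have hW : ¬ colourSet Δ Set.univ ⊆ colourSet Δ B := by
      intro hsub
      have := Set.ncard_le_ncard hsub (colourSet_finite hΔ B)
      rw [colourSet_univ hΔ, Set.ncard_coe_finset, Nat.card_Icc] at this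
      omega
    obtain ⟨B', hB', -, -, ⟨d, hd⟩ | ⟨x, -, hxB, -, rfl⟩⟩ :=
      hB.exists_extension (Set.subset_univ B) hW
    · refine ⟨B', hB', ?_⟩
      have h1 := Set.ncard_le_ncard hd ((colourSet_finite hΔ B).insert d)
      have h2 := Set.ncard_insert_le d (colourSet Δ B)
      omega
    · rcases le_total (newCols Δ x B).ncard n with hle | hle
      · refine ⟨_, hB', ?_⟩
        rw [colourSet_insert Δ hxB]
        have := Set.ncard_union_le (colourSet Δ B) (newCols Δ x B)
        omega
      · obtain ⟨T, S, hT, -, -, hS, hTS⟩ := hB.exists_of_le_ncard_newCols hΔ hxB hn hle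
        refine ⟨T, hT, ?_⟩
        have h1 := Set.ncard_le_ncard hTS ((colourSet_finite hΔ B).union S.finite_toSet)
        have h2 := Set.ncard_union_le (colourSet Δ B) S
        rw [Set.ncard_coe_finset] at h2
        omega

end Layered

theorem barU_succ (X : ℕ → Set ℕ) (i : ℕ) : barU X (i + 1) = barU X i ∪ X (i + 1) := by
  ext x
  simp only [barU, Set.mem_iUnion, Set.mem_union, Nat.le_succ_iff, exists_prop]
  grind

theorem barU_update_of_lt (X : ℕ → Set ℕ) (Y : Set ℕ) {i m : ℕ} (h : i < m) :
    barU (Function.update X m Y) i = barU X i := by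
  refine Set.iUnion₂_congr fun j hj => ?_
  rw [Function.update_of_ne (by omega)]

/-- The layers of a layered set, indexed from `0` to `m`. -/
theorem Layered.exists_tuple {Δ : ℕ → ℕ → ℕ} {n : ℕ} {B : Set ℕ} (h : Layered Δ n B) :
    ∃ (m : ℕ) (X : ℕ → Set ℕ), n = m + 1 ∧ barU X m = B ∧
      (∀ i < n, (X i).Nonempty) ∧
      (∀ i < n, ∀ j < n, i ≠ j → Disjoint (X i) (X j)) ∧
      ((X 0).Infinite ∧ (colourSet Δ (X 0)).ncard = 1) ∧
      (∀ i, i + 1 < n → colourSet Δ (barU X i) ⊂ colourSet Δ (barU X (i + 1))) ∧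
      (∀ i, i + 1 < n → ∀ v ∈ X (i + 1),
        newCols Δ v (barU X i) = colourSet Δ (barU X (i + 1)) \ colourSet Δ (barU X i)) := by
  induction h with
  | base A c hA hc =>
    refine ⟨0, fun _ => A, rfl, by simp [barU], fun _ _ => hA.nonempty, by grind,
      ⟨hA, by simp [hc]⟩, by grind, by grind⟩
  | snoc n B Y E hB hY hYB hE hN hC ih =>
    obtain ⟨m, X, rfl, hX, h1, h2, h3, h4, h5⟩ := ih
    have hlt : ∀ i < m + 1, Function.update X (m + 1) Y i = X i := fun i hi =>
      Function.update_of_ne (by omega) _ _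
    have hY' : Function.update X (m + 1) Y (m + 1) = Y := Function.update_self _ _ _
    have hbar : ∀ i < m + 1, barU (Function.update X (m + 1) Y) i = barU X i := fun i hi =>
      barU_update_of_lt X Y hi
    have hbar' : barU (Function.update X (m + 1) Y) (m + 1) = B ∪ Y := by
      rw [barU_succ, hbar m (by omega), hX, hY']
    have hdisj : ∀ i < m + 1, Disjoint (X i) Y := fun i hi =>
      hYB.mono_left (hX ▸ Set.subset_iUnion₂ (s := fun j (_ : j ≤ m) => X j) i (by omega))
    have hEB : Disjoint (colourSet Δ B) E := by
      obtain ⟨y, hy⟩ := hY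
      rw [← hN y hy]
      exact Set.disjoint_right.2 fun c hc => hc.2
    have split : ∀ i, i < m + 1 + 1 → i < m + 1 ∨ i = m + 1 := by omega
    refine ⟨m + 1, _, rfl, hbar', fun i hi => ?_, fun i hi j hj hij => ?_, ?_, fun i hi => ?_,
      fun i hi => ?_⟩
    · rcases split i hi with hi | rfl
      · rw [hlt i hi]
        exact h1 i hi
      · rwa [hY']
    · rcases split i hi with hi | rfl <;> rcases split j hj with hj | rfl
      · rw [hlt i hi, hlt j hj]
        exact h2 i hi j hj hij
      · rw [hlt i hi, hY']
        exact hdisj i hi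
      · rw [hlt j hj, hY']
        exact (hdisj j hj).symm
      · exact absurd rfl hij
    · rw [hlt 0 (by omega)]
      exact h3
    · rcases split (i + 1) hi with hi | hi
      · rw [hbar i (by omega), hbar _ hi]
        exact h4 i hi
      · obtain rfl : i = m := by omega
        rw [hbar', hbar i (by omega), hX, hC]
        refine ⟨Set.subset_union_left, fun hsub => ?_⟩
        obtain ⟨e, he⟩ := hE
        exact Set.disjoint_right.1 hEB he (hsub (Or.inr he))
    · rcases split (i + 1) hi with hi | hi
      · rw [hbar i (by omega), hbar _ hi, hlt _ hi]
        exact h5 i hi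
      · obtain rfl : i = m := by omega
        rw [hbar', hbar i (by omega), hX, hC, hY', Set.union_sdiff_cancel_left hEB.le_bot]
        exact hN

/-- **Theorem 6.** If `Δ : ℕ^(2) ↠ [k]` is a surjective colouring and `n ≥ 1` satisfies
`k ≥ n(n-1)/2 + 1`, then there exists an `n`-homogeneous tuple with respect to `Δ`. -/
theorem exists_nHomogeneous (k n : ℕ) (hn : 1 ≤ n) (Δ : ℕ → ℕ → ℕ)
    (hΔ : IsColouring Δ k) (hk : n * (n - 1) / 2 + 1 ≤ k) :
    ∃ X : ℕ → Set ℕ, Homog Δ n X := by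
  obtain ⟨B, hB, hBc⟩ := Layered.exists_ncard_le hΔ hn hk
  obtain ⟨m, X, rfl, rfl, h1, h2, h3, h4, h5⟩ := hB.exists_tuple
  exact ⟨X, h1, h2, h3, h4, h5, colourSet_finite hΔ _, hBc⟩
end

section
/- There exist a subset A ⊆ ℕ of asymptotic density one and a constant C > 0 such that for all sufficiently large k ∈ A, ψ(k) ≤ C · k / ((log log k)^δ · (log log log k)^(3/2)), where δ = 1 − (1 + log log 2)/log 2. -/
/-- `ψ k`: the minimum of `|F_Δ|` over all surjective colourings `Δ : ℕ^(2) ↠ [k]`. -/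
noncomputable def psi (k : ℕ) : ℕ :=
  sInf {m | ∃ Δ : ℕ → ℕ → ℕ, IsColouring Δ k ∧ (FSet Δ k).ncard = m}

/-- Some graph with `m` edges (given as two-element sets) has at most `s` distinct numbers
of edges in its induced subgraphs. -/
def HasSpectrumBound (m s : ℕ) : Prop :=
  ∃ E : Finset (Finset ℕ), (∀ e ∈ E, e.card = 2) ∧ E.card = m ∧
    ∃ V : Finset ℕ, V.card ≤ s ∧
      ∀ X : Set ℕ, {e | e ∈ E ∧ (e : Set ℕ) ⊆ X}.ncard ∈ V

lemma exists_nonedge (E : Finset (Finset ℕ)) {X : Set ℕ} (hX : X.Infinite) :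
    ∃ x ∈ X, ∃ y ∈ X, x ≠ y ∧ ({x, y} : Finset ℕ) ∉ E := by
  have h : (X \ (E.sup id : Finset ℕ)).Infinite := hX.sdiff (Finset.finite_toSet _)
  obtain ⟨x, hx, y, hy, hxy⟩ := h.nontrivial
  refine ⟨x, hx.1, y, hy.1, hxy, fun hE => hx.2 ?_⟩
  have : ({x, y} : Finset ℕ) ≤ E.sup id := Finset.le_sup (f := id) hE
  exact this (by simp)

lemma psi_le_of_hasSpectrumBound {m s : ℕ} (h : HasSpectrumBound m s) : psi (m + 1) ≤ s := by
  classical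
  obtain ⟨E, hE2, hEm, V, hVs, hV⟩ := h
  let col : Finset ℕ → ℕ := fun e => if h : e ∈ E then (E.equivFin ⟨e, h⟩ : ℕ) + 2 else 1
  have col_mem : ∀ e (h : e ∈ E), col e = (E.equivFin ⟨e, h⟩ : ℕ) + 2 := fun e h => dif_pos h
  have col_not : ∀ e, e ∉ E → col e = 1 := fun e h => dif_neg h
  have col_inj : Set.InjOn col (E : Set (Finset ℕ)) := by
    intro e he e' he' hee
    rw [col_mem e he, col_mem e' he'] at hee
    have : E.equivFin ⟨e, he⟩ = E.equivFin ⟨e', he'⟩ := Fin.ext (by omega)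
    simpa using this
  have edge : ∀ x y, edgeCol (fun x y => col {x, y}) x y = col {x, y} := by
    intro x y
    rcases le_total x y with h | h
    · simp [edgeCol, h]
    · simp [edgeCol, h, Finset.pair_comm]
  have hcol : IsColouring (fun x y => col {x, y}) (m + 1) := by
    refine ⟨fun x y _ => ?_, fun c hc => ?_⟩
    · rw [edge, Finset.mem_Icc]
      by_cases h : ({x, y} : Finset ℕ) ∈ E
      · rw [col_mem _ h]
        have := (E.equivFin ⟨_, h⟩).2
        omega
      · rw [col_not _ h]
        omega
    · rw [Finset.mem_Icc] at hc
      simp only [edge]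
      rcases hc.1.eq_or_lt with h1 | h1
      · obtain ⟨x, -, y, -, hxy, hn⟩ := exists_nonedge E Set.infinite_univ
        exact ⟨x, y, hxy, by rw [col_not _ hn, h1]⟩
      · obtain ⟨⟨e, he⟩, hee⟩ := E.equivFin.surjective ⟨c - 2, by omega⟩
        obtain ⟨x, y, hxy, rfl⟩ := Finset.card_eq_two.1 (hE2 e he)
        refine ⟨x, y, hxy, ?_⟩
        rw [col_mem _ he, hee]
        simp only
        omega
  have hcs : ∀ X : Set ℕ, X.Infinite → colourSet (fun x y => col {x, y}) X
      = insert 1 (col '' {e | e ∈ E ∧ (e : Set ℕ) ⊆ X}) := by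
    intro X hX
    ext c
    simp only [colourSet, edge, Set.mem_ofPred_eq, Set.mem_insert_iff, Set.mem_image]
    constructor
    · rintro ⟨x, hx, y, hy, -, rfl⟩
      by_cases h : ({x, y} : Finset ℕ) ∈ E
      · exact Or.inr ⟨_, ⟨h, by simp [Set.insert_subset_iff, hx, hy]⟩, rfl⟩
      · exact Or.inl (col_not _ h)
    · rintro (rfl | ⟨e, ⟨he, heX⟩, rfl⟩)
      · obtain ⟨x, hx, y, hy, hxy, hn⟩ := exists_nonedge E hX
        exact ⟨x, hx, y, hy, hxy, col_not _ hn⟩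
      · obtain ⟨x, y, hxy, rfl⟩ := Finset.card_eq_two.1 (hE2 e he)
        exact ⟨x, heX (by simp), y, heX (by simp), hxy, rfl⟩
  have hF : FSet (fun x y => col {x, y}) (m + 1) ⊆ (V.image (· + 1) : Finset ℕ) := by
    rintro c ⟨-, X, hX, rfl⟩
    rw [hcs X hX, Set.ncard_insert_of_notMem, Set.InjOn.ncard_image]
    · exact Finset.mem_coe.2 (Finset.mem_image.2 ⟨_, hV X, rfl⟩)
    · exact col_inj.mono fun e he => he.1
    · rintro ⟨e, he, h1⟩
      rw [col_mem e he.1] at h1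
      omega
  calc psi (m + 1) ≤ (FSet (fun x y => col {x, y}) (m + 1)).ncard := Nat.sInf_le ⟨_, hcol, rfl⟩
    _ ≤ ((V.image (· + 1) : Finset ℕ) : Set ℕ).ncard := Set.ncard_le_ncard hF (Finset.finite_toSet _)
    _ ≤ s := by
      rw [Set.ncard_coe_finset]
      exact Finset.card_image_le.trans hVs

lemma hasSpectrumBound_self (m : ℕ) : HasSpectrumBound m (m + 1) := by
  obtain ⟨E, hE, hEm⟩ := (Set.infinite_of_injective_forall_mem (s := {e : Finset ℕ | e.card = 2})
    (f := fun n : ℕ => ({n, n + 1} : Finset ℕ)) (fun a b hab => by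
      replace hab : ({a, a + 1} : Finset ℕ) = {b, b + 1} := hab
      have h1 : a ∈ ({b, b + 1} : Finset ℕ) := by simp [← hab]
      have h2 : b ∈ ({a, a + 1} : Finset ℕ) := by simp [hab]
      simp only [Finset.mem_insert, Finset.mem_singleton] at h1 h2
      omega) (fun n => Finset.card_pair (by omega))).exists_subset_card_eq m
  refine ⟨E, fun e he => hE he, hEm, Finset.range (m + 1), by simp, fun X => ?_⟩
  rw [Finset.mem_range, Nat.lt_succ_iff, ← hEm, ← Set.ncard_coe_finset]
  exact Set.ncard_le_ncard (fun e he => he.1) (Finset.finite_toSet _)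

/-- Adding a disjoint clique on `n` vertices multiplies the bound by at most `n`. -/
lemma HasSpectrumBound.add_choose_two {r s : ℕ} (h : HasSpectrumBound r s) {n : ℕ} (hn : 0 < n) :
    HasSpectrumBound (n.choose 2 + r) (n * s) := by
  classical
  obtain ⟨E, hE2, hEr, V, hVs, hV⟩ := h
  obtain ⟨B, hB⟩ := (E.sup id).exists_nat_subset_range
  let I := Finset.Ico B (B + n)
  have hdisj : Disjoint (I.powersetCard 2) E := by
    rw [Finset.disjoint_left]
    intro e he heE
    rw [Finset.mem_powersetCard] at he
    obtain ⟨x, hx⟩ := Finset.card_pos.1 (by omega : 0 < e.card)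
    have h1 := Finset.mem_Ico.1 (he.1 hx)
    have h2 := Finset.mem_range.1 (hB ((Finset.le_sup (f := id) heE : e ≤ E.sup id) hx))
    omega
  refine ⟨I.powersetCard 2 ∪ E, ?_, ?_,
    ((Finset.range n).image (fun i => (i + 1).choose 2) ×ˢ V).image (fun p => p.1 + p.2), ?_, ?_⟩
  · intro e he
    rcases Finset.mem_union.1 he with he | he
    · exact (Finset.mem_powersetCard.1 he).2
    · exact hE2 e he
  · rw [Finset.card_union_of_disjoint hdisj, Finset.card_powersetCard, hEr]
    simp [I]
  · refine Finset.card_image_le.trans ?_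
    rw [Finset.card_product]
    exact Nat.mul_le_mul (Finset.card_image_le.trans (by simp)) hVs
  · intro X
    have hsplit : {e : Finset ℕ | e ∈ I.powersetCard 2 ∪ E ∧ (e : Set ℕ) ⊆ X}
        = (((I.filter (· ∈ X)).powersetCard 2 : Finset (Finset ℕ)) : Set (Finset ℕ)) ∪
          {e | e ∈ E ∧ (e : Set ℕ) ⊆ X} := by
      ext e
      simp only [Set.mem_ofPred_eq, Finset.mem_union, Finset.mem_powersetCard, Set.mem_union,
        Finset.mem_coe, Finset.subset_iff, Finset.mem_filter, Set.subset_def]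
      grind
    have hcard : (I.filter (· ∈ X)).card ≤ n := by
      simpa [I] using Finset.card_filter_le I (· ∈ X)
    have hfin : {e | e ∈ E ∧ (e : Set ℕ) ⊆ X}.Finite := E.finite_toSet.subset fun e he => he.1
    rw [hsplit, Set.ncard_union_eq _ (Finset.finite_toSet _) hfin, Set.ncard_coe_finset, Finset.card_powersetCard]
    · refine Finset.mem_image.2 ⟨(_, _), Finset.mem_product.2 ⟨Finset.mem_image.2 ?_, hV X⟩, rfl⟩
      rcases Nat.eq_zero_or_pos (I.filter (· ∈ X)).card with h0 | h0
      · exact ⟨0, by simpa using hn, by simp [h0]⟩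
      · exact ⟨(I.filter (· ∈ X)).card - 1, by simp; omega, by simp only; congr 1; omega⟩
    · rw [Set.disjoint_left]
      intro e he he'
      exact Finset.disjoint_left.1 hdisj
        (Finset.powersetCard_mono (Finset.filter_subset _ _) (Finset.mem_coe.1 he)) he'.1

/-- The least number of distinct induced edge counts of a graph with `m` edges. -/
noncomputable def minSpectrum (m : ℕ) : ℕ := sInf {s | HasSpectrumBound m s}

lemma hasSpectrumBound_minSpectrum (m : ℕ) : HasSpectrumBound m (minSpectrum m) :=
  Nat.sInf_mem (s := {s | HasSpectrumBound m s}) ⟨_, hasSpectrumBound_self m⟩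

lemma minSpectrum_le (m : ℕ) : minSpectrum m ≤ m + 1 := Nat.sInf_le (hasSpectrumBound_self m)

lemma minSpectrum_add_choose_two (n r : ℕ) (hn : 0 < n) :
    minSpectrum (n.choose 2 + r) ≤ n * minSpectrum r :=
  Nat.sInf_le ((hasSpectrumBound_minSpectrum r).add_choose_two hn)

lemma psi_succ_le_minSpectrum (m : ℕ) : psi (m + 1) ≤ minSpectrum m :=
  psi_le_of_hasSpectrumBound (hasSpectrumBound_minSpectrum m)

/-- The sum of the square roots of `minSpectrum` below `N`. -/
noncomputable def sqrtSum (N : ℕ) : ℝ := ∑ m ∈ Finset.range N, √(minSpectrum m : ℝ)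

lemma sqrtSum_mono : Monotone sqrtSum := fun _ _ h =>
  Finset.sum_le_sum_of_subset_of_nonneg (Finset.range_mono h) fun _ _ _ => Real.sqrt_nonneg _

lemma sqrtSum_le (N : ℕ) : sqrtSum N ≤ N * √(N : ℝ) := by
  calc sqrtSum N ≤ ∑ m ∈ Finset.range N, √(N : ℝ) := by
        refine Finset.sum_le_sum fun m hm => Real.sqrt_le_sqrt ?_
        exact_mod_cast (minSpectrum_le m).trans (Finset.mem_range.1 hm)
    _ = N * √(N : ℝ) := by simp

lemma sqrtSum_choose_two (M : ℕ) :
    sqrtSum (M.choose 2) ≤ ∑ n ∈ Finset.range M, √(n : ℝ) * sqrtSum n := by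
  induction M with
  | zero => simp [sqrtSum]
  | succ M ih =>
    rcases Nat.eq_zero_or_pos M with rfl | hM
    · simp [sqrtSum]
    rw [Finset.sum_range_succ, Nat.choose_succ_succ' M 1, Nat.choose_one_right, add_comm M]
    have : sqrtSum (M.choose 2 + M) = sqrtSum (M.choose 2)
        + ∑ r ∈ Finset.range M, √(minSpectrum (M.choose 2 + r) : ℝ) := by
      simp only [sqrtSum, Finset.sum_range_add]
    rw [this]
    refine add_le_add ih ?_
    rw [sqrtSum, Finset.mul_sum]
    refine Finset.sum_le_sum fun r _ => ?_
    rw [← Real.sqrt_mul (Nat.cast_nonneg _)]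
    exact Real.sqrt_le_sqrt (by exact_mod_cast minSpectrum_add_choose_two M r hM)

lemma sum_range_sq_le (M : ℕ) : ∑ n ∈ Finset.range M, (n : ℝ) ^ 2 ≤ (M : ℝ) ^ 3 / 3 := by
  induction M with
  | zero => simp
  | succ M ih =>
    rw [Finset.sum_range_succ]
    push_cast
    have : (0 : ℝ) ≤ M := Nat.cast_nonneg _
    nlinarith

lemma exists_choose_two_near (N : ℕ) (hN : 0 < N) :
    ∃ M : ℕ, N ≤ M.choose 2 ∧ (M - 1).choose 2 < N := by
  classical
  have hex : ∃ M : ℕ, N ≤ M.choose 2 := ⟨N + 1, by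
    rw [Nat.choose_succ_succ' N 1, Nat.choose_one_right]; omega⟩
  refine ⟨Nat.find hex, Nat.find_spec hex, ?_⟩
  have hpos : 0 < Nat.find hex := by
    rw [Nat.find_pos]; simp; omega
  exact not_le.1 (Nat.find_min hex (by omega))

lemma sqrtSum_choose_two_le {a : ℝ} (ha : 0 ≤ a) {N₀ M : ℕ}
    (h : ∀ n, N₀ ≤ n → sqrtSum n ≤ a * (n * √(n : ℝ))) :
    sqrtSum (M.choose 2) ≤ (N₀ : ℝ) ^ 3 + a * ((M : ℝ) ^ 3 / 3) := by
  have hs : ∀ n : ℕ, √(n : ℝ) * (n * √(n : ℝ)) = (n : ℝ) ^ 2 := fun n => by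
    rw [mul_left_comm, Real.mul_self_sqrt (Nat.cast_nonneg _), sq]
  have key : ∀ n ∈ Finset.range M, √(n : ℝ) * sqrtSum n
      ≤ (if n < N₀ then (n : ℝ) ^ 2 else 0) + a * (n : ℝ) ^ 2 := by
    intro n _
    split_ifs with hn
    · have := mul_le_mul_of_nonneg_left (sqrtSum_le n) (Real.sqrt_nonneg (n : ℝ))
      rw [hs] at this
      nlinarith [mul_nonneg ha (sq_nonneg (n : ℝ))]
    · have := mul_le_mul_of_nonneg_left (h n (not_lt.1 hn)) (Real.sqrt_nonneg (n : ℝ))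
      rw [mul_left_comm, hs] at this
      linarith
  refine (sqrtSum_choose_two M).trans ((Finset.sum_le_sum key).trans ?_)
  rw [Finset.sum_add_distrib, ← Finset.mul_sum]
  refine add_le_add ?_ (mul_le_mul_of_nonneg_left (sum_range_sq_le M) ha)
  rw [← Finset.sum_filter]
  calc ∑ n ∈ Finset.range M with n < N₀, (n : ℝ) ^ 2
      ≤ ∑ n ∈ Finset.range N₀, (n : ℝ) ^ 2 :=
        Finset.sum_le_sum_of_subset_of_nonneg (fun n hn => by simp at hn ⊢; exact hn.2)
          fun _ _ _ => sq_nonneg _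
    _ ≤ (N₀ : ℝ) ^ 3 / 3 := sum_range_sq_le N₀
    _ ≤ (N₀ : ℝ) ^ 3 := by
      have : (0 : ℝ) ≤ (N₀ : ℝ) ^ 3 := by positivity
      linarith

lemma sqrtSum_contract {a : ℝ} (ha : 0 ≤ a) {N₀ : ℕ} (hN₀ : 1000 ≤ N₀) (haN : 1 ≤ a * N₀)
    (h : ∀ n, N₀ ≤ n → sqrtSum n ≤ a * (n * √(n : ℝ))) {N : ℕ} (hN : N₀ ^ 4 ≤ N) :
    sqrtSum N ≤ a * (0.993 : ℝ) ^ 4 * (N * √(N : ℝ)) := by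
  have hN0 : 0 < N := lt_of_lt_of_le (by positivity) hN
  obtain ⟨M, hM1, hM2⟩ := exists_choose_two_near N hN0
  have hMN : N₀ ^ 2 ≤ M := by
    by_contra! hlt
    have h1 : M.choose 2 ≤ M ^ 2 := Nat.choose_le_pow M 2
    have h2 : M ^ 2 < (N₀ ^ 2) ^ 2 := Nat.pow_lt_pow_left hlt (by norm_num)
    rw [← pow_mul] at h2
    exact absurd (hN.trans (hM1.trans h1)) (not_le.2 h2)
  have hMbig : 1000000 ≤ M := by nlinarith
  have hMNr : (N₀ : ℝ) ^ 2 ≤ M := by exact_mod_cast hMN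
  have hMr : (1000000 : ℝ) ≤ M := by exact_mod_cast hMbig
  have hN₀r : (1000 : ℝ) ≤ N₀ := by exact_mod_cast hN₀
  have hNr : 0.499 * (M : ℝ) ^ 2 ≤ N := by
    have h1 : (((M - 1).choose 2 : ℕ) : ℝ) ≤ N := by exact_mod_cast hM2.le
    rw [Nat.cast_choose_two, Nat.cast_sub (by omega), Nat.cast_one] at h1
    nlinarith
  have hsq : 0.706 * (M : ℝ) ≤ √(N : ℝ) := by
    apply Real.le_sqrt_of_sq_le
    nlinarith
  have hNs : 0.352 * (M : ℝ) ^ 3 ≤ N * √(N : ℝ) := by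
    have := mul_le_mul hNr hsq (by positivity) (by positivity)
    have h3 : (0 : ℝ) ≤ (M : ℝ) ^ 3 := by positivity
    nlinarith
  have hsmall : (N₀ : ℝ) ^ 3 ≤ a * (0.001 * (M : ℝ) ^ 3) := by
    have h6 : ((N₀ : ℝ) ^ 2) ^ 3 ≤ (M : ℝ) ^ 3 := pow_le_pow_left₀ (by positivity) hMNr 3
    have h5 : (N₀ : ℝ) ^ 5 ≤ a * (M : ℝ) ^ 3 := by
      calc (N₀ : ℝ) ^ 5 ≤ (a * N₀) * (N₀ : ℝ) ^ 5 := le_mul_of_one_le_left (by positivity) haN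
        _ = a * ((N₀ : ℝ) ^ 2) ^ 3 := by ring
        _ ≤ _ := mul_le_mul_of_nonneg_left h6 ha
    have h2 : (N₀ : ℝ) ^ 3 * 1000 ≤ (N₀ : ℝ) ^ 3 * (N₀ : ℝ) ^ 2 :=
      mul_le_mul_of_nonneg_left (by nlinarith) (by positivity)
    nlinarith
  calc sqrtSum N ≤ sqrtSum (M.choose 2) := sqrtSum_mono hM1
    _ ≤ (N₀ : ℝ) ^ 3 + a * ((M : ℝ) ^ 3 / 3) := sqrtSum_choose_two_le ha h
    _ ≤ a * ((0.993 : ℝ) ^ 4 * (0.352 * (M : ℝ) ^ 3)) := by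
      have h3 : 0 ≤ a * (M : ℝ) ^ 3 := by positivity
      norm_num
      nlinarith
    _ ≤ a * ((0.993 : ℝ) ^ 4 * (N * √(N : ℝ))) := by gcongr
    _ = _ := by ring

lemma sqrtSum_le_pow (j : ℕ) : ∀ N : ℕ, 1000 ^ 4 ^ j ≤ N →
    sqrtSum N ≤ ((0.993 : ℝ) ^ 4) ^ j * (N * √(N : ℝ)) := by
  induction j with
  | zero => intro N _; simpa using sqrtSum_le N
  | succ j ih =>
    intro N hN
    rw [pow_succ]
    refine sqrtSum_contract (by positivity) (Nat.le_self_pow (by positivity) _) ?_ ih ?_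
    · have h1 : (1 : ℝ) ≤ (0.993 : ℝ) ^ 4 * 1000 := by norm_num
      calc (1 : ℝ) ≤ ((0.993 : ℝ) ^ 4 * 1000) ^ j := one_le_pow₀ h1
        _ = ((0.993 : ℝ) ^ 4) ^ j * 1000 ^ j := mul_pow _ _ _
        _ ≤ ((0.993 : ℝ) ^ 4) ^ j * ((1000 ^ 4 ^ j : ℕ) : ℝ) := by
          push_cast
          gcongr
          · norm_num
          · exact (Nat.lt_pow_self (by norm_num)).le
    · rwa [← pow_mul, ← pow_succ]

/-- The number of times the contraction estimate applies below `k`. -/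
def depth (k : ℕ) : ℕ := Nat.log 4 (Nat.log 1000 k)

lemma depth_mono : Monotone depth := fun _ _ h => Nat.log_mono_right (Nat.log_mono_right h)

lemma pow_depth_le {k : ℕ} (hk : 1000 ≤ k) : 1000 ^ 4 ^ depth k ≤ k :=
  (Nat.pow_le_pow_right (by norm_num)
    (Nat.pow_log_le_self 4 (Nat.log_pos (by norm_num) hk).ne')).trans
    (Nat.pow_log_le_self 1000 (by omega))

lemma lt_pow_depth_succ (k : ℕ) : k < 1000 ^ 4 ^ (depth k + 1) :=
  (Nat.lt_pow_succ_log_self (by norm_num) k).trans_le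
    (Nat.pow_le_pow_right (by norm_num) (Nat.lt_pow_succ_log_self (by norm_num) _))

lemma tendsto_depth : Filter.Tendsto depth Filter.atTop Filter.atTop := by
  refine Filter.tendsto_atTop_atTop_of_monotone depth_mono fun j => ⟨1000 ^ 4 ^ j, ?_⟩
  simp [depth, Nat.log_pow]

/-- The `k` for which `ψ` is as small as the contraction estimate predicts. -/
def goodSet : Set ℕ := {k | (psi k : ℝ) ≤ ((0.993 : ℝ) ^ 4) ^ depth k * k}

lemma ncard_bad_le {N : ℕ} (hN : 1000 ≤ N) :
    ((Set.Icc 1 N \ goodSet).ncard : ℝ) ≤ 2 * (0.993 : ℝ) ^ depth N * N := by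
  classical
  set q : ℝ := 0.993 ^ depth N with hq
  have hq0 : 0 < q := by positivity
  have hq1 : q ≤ 1 := pow_le_one₀ (by norm_num) (by norm_num)
  have hNpos : (0 : ℝ) < N := by exact_mod_cast (by omega : 0 < N)
  have hS : sqrtSum N ≤ q ^ 4 * (N * √(N : ℝ)) := by
    have := sqrtSum_le_pow (depth N) N (pow_depth_le hN)
    rwa [← pow_mul, mul_comm 4, pow_mul, ← hq] at this
  let L := Finset.Icc 1 ⌊q ^ 2 * N⌋₊
  let B := (Finset.range N).filter (fun m => q ^ 3 * √(N : ℝ) ≤ √(minSpectrum m : ℝ))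
  have hsub : Set.Icc 1 N \ goodSet ⊆ ((L ∪ B.image (· + 1) : Finset ℕ) : Set ℕ) := by
    rintro k ⟨⟨hk1, hkN⟩, hk⟩
    simp only [goodSet, Set.mem_ofPred_eq, not_le] at hk
    rw [Finset.mem_coe, Finset.mem_union]
    by_cases hkL : (k : ℝ) ≤ q ^ 2 * N
    · exact Or.inl (Finset.mem_Icc.2 ⟨hk1, Nat.le_floor hkL⟩)
    · right
      obtain ⟨m, rfl⟩ : ∃ m, k = m + 1 := ⟨k - 1, by omega⟩
      refine Finset.mem_image.2 ⟨m, Finset.mem_filter.2 ⟨Finset.mem_range.2 (by omega), ?_⟩, rfl⟩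
      apply Real.le_sqrt_of_sq_le
      rw [mul_pow, Real.sq_sqrt hNpos.le]
      have hp : (psi (m + 1) : ℝ) ≤ minSpectrum m := by exact_mod_cast psi_succ_le_minSpectrum m
      have hd : q ^ 4 ≤ ((0.993 : ℝ) ^ 4) ^ depth (m + 1) := by
        rw [hq, ← pow_mul, mul_comm, pow_mul]
        exact pow_le_pow_of_le_one (by positivity) (by norm_num) (depth_mono hkN)
      have := mul_le_mul hd (not_le.1 hkL).le (by positivity) (by positivity)
      calc (q ^ 3) ^ 2 * N = q ^ 4 * (q ^ 2 * N) := by ring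
        _ ≤ _ := this.trans (hk.le.trans hp)
  have hB : (B.card : ℝ) ≤ q * N := by
    have h1 : B.card * (q ^ 3 * √(N : ℝ)) ≤ sqrtSum N := by
      rw [← nsmul_eq_mul]
      refine (Finset.card_nsmul_le_sum B _ _ fun m hm => (Finset.mem_filter.1 hm).2).trans ?_
      exact Finset.sum_le_sum_of_subset_of_nonneg (Finset.filter_subset _ _)
        fun _ _ _ => Real.sqrt_nonneg _
    have h2 : 0 < q ^ 3 * √(N : ℝ) := by positivity
    refine le_of_mul_le_mul_right (h1.trans (hS.trans_eq ?_)) h2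
    ring
  have hL : (L.card : ℝ) ≤ q * N := by
    have : (L.card : ℝ) ≤ q ^ 2 * N := by
      simpa [L] using Nat.floor_le (by positivity : 0 ≤ q ^ 2 * N)
    refine this.trans (mul_le_mul_of_nonneg_right ?_ hNpos.le)
    nlinarith
  have hcard : (Set.Icc 1 N \ goodSet).ncard ≤ L.card + B.card := by
    refine (Set.ncard_le_ncard hsub (Finset.finite_toSet _)).trans ?_
    rw [Set.ncard_coe_finset]
    exact (Finset.card_union_le _ _).trans (Nat.add_le_add_left Finset.card_image_le _)
  have : ((Set.Icc 1 N \ goodSet).ncard : ℝ) ≤ L.card + B.card := by exact_mod_cast hcard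
  linarith

lemma tendsto_density_goodSet :
    Filter.Tendsto (fun N : ℕ => ((goodSet ∩ Set.Icc 1 N).ncard : ℝ) / N)
      Filter.atTop (nhds 1) := by
  have hlow : Filter.Tendsto (fun N : ℕ => 1 - 2 * (0.993 : ℝ) ^ depth N)
      Filter.atTop (nhds 1) := by
    have := ((tendsto_pow_atTop_nhds_zero_of_lt_one (r := (0.993 : ℝ)) (by norm_num)
      (by norm_num)).comp tendsto_depth).const_mul 2
    simpa using this.const_sub 1
  have hcount : ∀ N : ℕ, ((goodSet ∩ Set.Icc 1 N).ncard : ℝ)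
      = N - (Set.Icc 1 N \ goodSet).ncard := by
    intro N
    have h := Set.ncard_inter_add_ncard_sdiff_eq_ncard (Set.Icc 1 N) goodSet (Set.finite_Icc 1 N)
    rw [Set.inter_comm, ← Finset.coe_Icc, Set.ncard_coe_finset, Nat.card_Icc,
      Nat.add_sub_cancel, Finset.coe_Icc] at h
    rw [eq_sub_iff_add_eq]
    exact_mod_cast h
  refine tendsto_of_tendsto_of_tendsto_of_le_of_le' hlow tendsto_const_nhds ?_ ?_
  · filter_upwards [Filter.eventually_ge_atTop 1000] with N hN
    have hNpos : (0 : ℝ) < N := by exact_mod_cast (by omega : 0 < N)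
    rw [le_div_iff₀ hNpos, hcount]
    linarith [ncard_bad_le hN]
  · filter_upwards [Filter.eventually_ge_atTop 1000] with N hN
    have hNpos : (0 : ℝ) < N := by exact_mod_cast (by omega : 0 < N)
    rw [div_le_one hNpos, hcount]
    linarith [Nat.cast_nonneg (α := ℝ) (Set.Icc 1 N \ goodSet).ncard]

lemma log_log_le_depth {k : ℕ} (hk : 3 ≤ k) :
    Real.log (Real.log k) ≤ 3 * (depth k + 6) := by
  have hlog4 : Real.log 4 ≤ 3 := by linarith [Real.log_le_sub_one_of_pos (by norm_num : (0:ℝ) < 4)]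
  have hlog1000 : Real.log 1000 ≤ 999 := by
    linarith [Real.log_le_sub_one_of_pos (by norm_num : (0:ℝ) < 1000)]
  have hkr : (1 : ℝ) < k := by exact_mod_cast (by omega : 1 < k)
  have h1 : Real.log k ≤ 4 ^ (depth k + 6) := by
    have : (k : ℝ) ≤ 1000 ^ 4 ^ (depth k + 1) := by exact_mod_cast (lt_pow_depth_succ k).le
    calc Real.log k ≤ Real.log (1000 ^ 4 ^ (depth k + 1)) := Real.log_le_log (by linarith) this
      _ = 4 ^ (depth k + 1) * Real.log 1000 := by rw [Real.log_pow]; push_cast; rfl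
      _ ≤ 4 ^ (depth k + 1) * 4 ^ 5 := by gcongr; linarith
      _ = _ := by rw [← pow_add]
  calc Real.log (Real.log k) ≤ Real.log (4 ^ (depth k + 6)) :=
        Real.log_le_log (Real.log_pos hkr) h1
    _ = (depth k + 6) * Real.log 4 := by rw [Real.log_pow]; push_cast; rfl
    _ ≤ (depth k + 6) * 3 := by gcongr
    _ = _ := mul_comm _ _

lemma one_sub_div_log_two_le_one : 1 - (1 + Real.log (Real.log 2)) / Real.log 2 ≤ 1 := by
  have h2 := Real.log_two_gt_d9
  have h0 : 0 < Real.log 2 := by linarith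
  have h := Real.one_sub_inv_le_log_of_pos h0
  have hi : (Real.log 2)⁻¹ ≤ 2 := by
    rw [inv_le_comm₀ h0 (by norm_num)]
    linarith
  have : 0 ≤ (1 + Real.log (Real.log 2)) / Real.log 2 := div_nonneg (by linarith) h0.le
  linarith

lemma denominator_le_cube {x δ : ℝ} (hx : Real.exp 1 ≤ x) (hδ : δ ≤ 1) :
    x ^ δ * Real.log x ^ ((3 : ℝ) / 2) ≤ x ^ 3 := by
  have he : (1 : ℝ) ≤ Real.exp 1 := Real.one_le_exp (by norm_num)
  have hx1 : 1 ≤ x := he.trans hx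
  have hlog : 0 ≤ Real.log x := Real.log_nonneg hx1
  have h1 : x ^ δ ≤ x ^ (1 : ℝ) := Real.rpow_le_rpow_of_exponent_le hx1 hδ
  have h2 : Real.log x ^ ((3 : ℝ) / 2) ≤ x ^ (2 : ℝ) :=
    (Real.rpow_le_rpow hlog (by linarith [Real.log_le_sub_one_of_pos (by linarith : 0 < x)])
      (by norm_num)).trans (Real.rpow_le_rpow_of_exponent_le hx1 (by norm_num))
  calc x ^ δ * Real.log x ^ ((3 : ℝ) / 2) ≤ x ^ (1 : ℝ) * x ^ (2 : ℝ) := by gcongr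
    _ = x ^ 3 := by
      rw [← Real.rpow_add (by linarith)]
      norm_num

lemma exists_pow_mul_cube_le :
    ∃ C : ℝ, 0 < C ∧ ∀ j : ℕ, ((0.993 : ℝ) ^ 4) ^ j * (3 * (j + 6)) ^ 3 ≤ C := by
  have ht : Filter.Tendsto (fun n : ℕ => (n : ℝ) ^ 3 * ((0.993 : ℝ) ^ 4) ^ n)
      Filter.atTop (nhds 0) :=
    tendsto_pow_const_mul_const_pow_of_lt_one 3 (by norm_num) (by norm_num)
  obtain ⟨b, hb⟩ := ht.bddAbove_range
  have hb' : ∀ n : ℕ, (n : ℝ) ^ 3 * ((0.993 : ℝ) ^ 4) ^ n ≤ b := fun n => hb ⟨n, rfl⟩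
  have hb0 : 0 ≤ b := by simpa using hb' 0
  have hr : (0 : ℝ) < ((0.993 : ℝ) ^ 4) ^ 6 := by positivity
  refine ⟨27 * b / ((0.993 : ℝ) ^ 4) ^ 6 + 1, by positivity, fun j => ?_⟩
  have h : ((0.993 : ℝ) ^ 4) ^ j * (3 * (j + 6)) ^ 3 ≤ 27 * b / ((0.993 : ℝ) ^ 4) ^ 6 := by
    rw [le_div_iff₀ hr]
    have := hb' (j + 6)
    rw [pow_add] at this
    push_cast at this
    linarith
  linarith

/-- **Theorem 2.** There are a set `A ⊆ ℕ` of asymptotic density one and a constant `C > 0`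
such that for all sufficiently large `k ∈ A`,
`ψ(k) ≤ C·k / ((log log k)^δ · (log log log k)^(3/2))`, where
`δ = 1 - (1 + log log 2)/log 2` and `log` is the natural logarithm. -/
theorem psi_upper_bound_density_one :
    ∃ (A : Set ℕ) (C : ℝ), 0 < C ∧
      Filter.Tendsto (fun N : ℕ => ((A ∩ Set.Icc 1 N).ncard : ℝ) / N)
        Filter.atTop (nhds 1) ∧
      ∃ K : ℕ, ∀ k ∈ A, K ≤ k →
        (psi k : ℝ) ≤ C * k /
          ((Real.log (Real.log k)) ^ (1 - (1 + Real.log (Real.log 2)) / Real.log 2) *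
            (Real.log (Real.log (Real.log k))) ^ ((3 : ℝ) / 2)) := by
  obtain ⟨C, hC, hCj⟩ := exists_pow_mul_cube_le
  have hloglog : Filter.Tendsto (fun k : ℕ => Real.log (Real.log k)) Filter.atTop Filter.atTop :=
    Real.tendsto_log_atTop.comp (Real.tendsto_log_atTop.comp tendsto_natCast_atTop_atTop)
  obtain ⟨K, hK⟩ := Filter.eventually_atTop.1
    (hloglog.eventually (Filter.eventually_gt_atTop (Real.exp 1)))
  refine ⟨goodSet, C, hC, tendsto_density_goodSet, max K 3, fun k hkA hk => ?_⟩
  set x := Real.log (Real.log k)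
  have hx : Real.exp 1 < x := hK k ((le_max_left _ _).trans hk)
  have hx0 : 0 < x := (Real.exp_pos 1).trans hx
  have hlog : 0 < Real.log x :=
    Real.log_pos ((Real.one_le_exp (by norm_num)).trans_lt hx)
  have hden : 0 < x ^ (1 - (1 + Real.log (Real.log 2)) / Real.log 2)
      * Real.log x ^ ((3 : ℝ) / 2) := by positivity
  rw [le_div_iff₀ hden]
  calc _ ≤ (((0.993 : ℝ) ^ 4) ^ depth k * k) * (3 * (depth k + 6)) ^ 3 := by
        refine mul_le_mul hkA ?_ hden.le (by positivity)
        refine (denominator_le_cube hx.le one_sub_div_log_two_le_one).trans ?_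
        exact pow_le_pow_left₀ hx0.le (log_log_le_depth ((le_max_right _ _).trans hk)) 3
    _ = (((0.993 : ℝ) ^ 4) ^ depth k * (3 * (depth k + 6)) ^ 3) * k := by ring
    _ ≤ C * k := by gcongr; exact hCj _
end
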